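/- arXiv:1903.09402 — 4 statements merged into one kernel-verified Lean document; each statement's English description precedes it below -/
import Mathlib

section
/- Let V be a finite nonempty vertex set and G a connected simple graph on V. Let d : ℕ → V → Finset V be a data-sharing process satisfying: (i) initialization: d 0 v = {v} for every v; (ii) monotonicity: d τ v ⊆ d (τ+1) v for every τ and v; (iii) locality: for every τ and v, any datum k ∈ d (τ+1) v with k ∉ d τ v satisfies k ∈ d τ u for some vertex u adjacent to v in G; (iv) single reception: for every τ and v, the set d (τ+1) v \ d τ v has at most one element; (v) progress: for every τ, if there exist adjacent vertices u, v and a datum k with k ∈ d τ u and k ∉ d τ v, then d (τ+1) w ≠ d τ w for some vertex w. Then there exists a time τ_end such that d τ_end v = V for every vertex v, i.e., all data initially possessed by the vertices are shared with all vertices in finite time. -/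
/-- In a connected graph, a property that holds at some vertex and passes to adjacent vertices
holds at every vertex. -/
theorem SimpleGraph.Connected.forall_of_adj {V : Type*} {G : SimpleGraph V} (hG : G.Connected)
    {p : V → Prop} (hadj : ∀ u v, G.Adj u v → p u → p v) {u : V} (hu : p u) (v : V) : p v := by
  obtain ⟨w⟩ := hG.preconnected u v
  induction w with
  | nil => exact hu
  | cons h _ ih => exact ih (hadj _ _ h hu)

/-- Theorem 1 of the paper: if the vehicular network graph is connected,
the data-sharing process terminates with all data shared with all vehicles
in finite time. -/
theorem data_sharing_completes {V : Type*} [Fintype V] [DecidableEq V] [Nonempty V]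
    (G : SimpleGraph V) (hG : G.Connected)
    (d : ℕ → V → Finset V)
    (hinit : ∀ v, d 0 v = {v})
    (hmono : ∀ τ v, d τ v ⊆ d (τ + 1) v)
    (hloc : ∀ τ v, ∀ k ∈ d (τ + 1) v, k ∉ d τ v → ∃ u, G.Adj u v ∧ k ∈ d τ u)
    (hone : ∀ τ v, (d (τ + 1) v \ d τ v).card ≤ 1)
    (hprog : ∀ τ, (∃ u v k, G.Adj u v ∧ k ∈ d τ u ∧ k ∉ d τ v) →
      ∃ w, d (τ + 1) w ≠ d τ w) :
    ∃ τend, ∀ v, d τend v = Finset.univ := by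
  have hd : Monotone d := monotone_nat_of_le_succ hmono
  obtain ⟨τ, hτ⟩ := WellFoundedGT.monotone_chain_condition
    (⟨d, hd⟩ : ℕ →o (V → Finset V))
  have hstable : d τ = d (τ + 1) := hτ (τ + 1) τ.le_succ
  have hadj (k u v : V) (huv : G.Adj u v) (hk : k ∈ d τ u) : k ∈ d τ v := by
    by_contra hkv
    obtain ⟨w, hw⟩ := hprog τ ⟨u, v, k, huv, hk, hkv⟩
    exact hw (congrFun hstable w).symm
  have hself (k : V) : k ∈ d τ k := hd τ.zero_le k (by simp [hinit])
  exact ⟨τ, fun v => Finset.eq_univ_iff_forall.2 fun k => hG.forall_of_adj (hadj k) (hself k) v⟩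
end

section
/- Let V be a finite nonempty vertex set with |V| = N and G a connected simple graph on V. Let d : ℕ → V → Finset V satisfy: (i) d 0 v = {v} for every v; (ii) d τ v ⊆ d (τ+1) v for every τ and v; (iii) any datum k ∈ d (τ+1) v with k ∉ d τ v satisfies k ∈ d τ u for some u adjacent to v in G; (iv) the set d (τ+1) v \ d τ v has at most one element for every τ and v; (v) if there exist adjacent vertices u, v and a datum k with k ∈ d τ u and k ∉ d τ v, then d (τ+1) w ≠ d τ w for some w. Then d (N² − N) v = V for every vertex v; that is, data sharing is complete within N² − N time slots. -/
/-- On a connected graph, if the sets attached to adjacent vertices are nested and each vertex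
lies in its own set, then every set is the whole vertex type. -/
theorem SimpleGraph.Connected.eq_univ_of_adj_subset {V : Type*} [Fintype V]
    {G : SimpleGraph V} (hG : G.Connected) {s : V → Finset V} (hself : ∀ v, v ∈ s v)
    (hadj : ∀ u v, G.Adj u v → s u ⊆ s v) (v : V) : s v = Finset.univ := by
  have hwalk : ∀ {u w : V}, G.Walk u w → s u ⊆ s w := by
    intro u w p
    induction p with
    | nil => exact Finset.Subset.refl _
    | cons h _ ih => exact (hadj _ _ h).trans ih
  refine Finset.eq_univ_iff_forall.2 fun k => ?_
  obtain ⟨p⟩ := hG.preconnected k v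
  exact hwalk p (hself k)

/-- Upper bound of Corollary 1 of the paper: with `N = |V|` vehicles and a
connected vehicular network graph, data sharing completes within `N² - N`
time slots. -/
theorem data_sharing_completes_by_upper_bound {V : Type*} [Fintype V] [DecidableEq V]
    [Nonempty V]
    (N : ℕ) (hN : Fintype.card V = N)
    (G : SimpleGraph V) (hG : G.Connected)
    (d : ℕ → V → Finset V)
    (hinit : ∀ v, d 0 v = {v})
    (hmono : ∀ τ v, d τ v ⊆ d (τ + 1) v)
    (hloc : ∀ τ v, ∀ k ∈ d (τ + 1) v, k ∉ d τ v → ∃ u, G.Adj u v ∧ k ∈ d τ u)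
    (hone : ∀ τ v, (d (τ + 1) v \ d τ v).card ≤ 1)
    (hprog : ∀ τ, (∃ u v k, G.Adj u v ∧ k ∈ d τ u ∧ k ∉ d τ v) →
      ∃ w, d (τ + 1) w ≠ d τ w) :
    ∀ v, d (N ^ 2 - N) v = Finset.univ := by
  have hself : ∀ τ v, v ∈ d τ v := fun τ v => by
    induction τ with
    | zero => simp [hinit]
    | succ τ ih => exact hmono τ v ih
  have key : ∀ τ, (∀ v, d τ v = Finset.univ) ∨ N + τ ≤ ∑ v, (d τ v).card := by
    intro τ
    induction τ with
    | zero => simp [hinit, hN]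
    | succ τ ih =>
      by_cases hτ : ∀ v, d τ v = Finset.univ
      · exact Or.inl fun v => Finset.univ_subset_iff.1 (hτ v ▸ hmono τ v)
      · right
        have hle := ih.resolve_left hτ
        have hex : ∃ u v k, G.Adj u v ∧ k ∈ d τ u ∧ k ∉ d τ v := by
          by_contra! h
          exact hτ (hG.eq_univ_of_adj_subset (hself τ) fun u v huv k hk => h u v k huv hk)
        obtain ⟨w, hw⟩ := hprog τ hex
        have hlt : ∑ v, (d τ v).card < ∑ v, (d (τ + 1) v).card :=
          Finset.sum_lt_sum (fun v _ => Finset.card_le_card (hmono τ v))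
            ⟨w, Finset.mem_univ w, Finset.card_lt_card ((hmono τ w).ssubset_of_ne hw.symm)⟩
        omega
  rcases key (N ^ 2 - N) with h | h
  · exact h
  · have hsq : N ≤ N ^ 2 := Nat.le_self_pow two_ne_zero N
    have hcard : ∀ v ∈ Finset.univ, (d (N ^ 2 - N) v).card ≤ N :=
      fun v _ => hN ▸ Finset.card_le_univ _
    have hsum : ∑ _v : V, N = N ^ 2 := by simp [hN, sq]
    have heq := (Finset.sum_eq_sum_iff_of_le hcard).1
      (le_antisymm (Finset.sum_le_sum hcard) (by omega))
    exact fun v => (Finset.card_eq_iff_eq_univ _).1 ((heq v (Finset.mem_univ v)).trans hN.symm)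
end

section
/- Let V be a finite vertex set with |V| = N ≥ 2, and let d : ℕ → V → Finset V satisfy: (i) d 0 v = {v} for every v; (ii) d τ v ⊆ d (τ+1) v for every τ and v; (iii) half-duplex concurrency bound: for every τ, the total number of data received in slot τ satisfies Σ_{v ∈ V} |d (τ+1) v| ≤ Σ_{v ∈ V} |d τ v| + ⌊N/2⌋. If τ_end is a time slot at which sharing is complete, i.e., d τ_end v = V for every vertex v, then ⌊N/2⌋ · τ_end ≥ N² − N (equivalently, τ_end ≥ (N² − N)/⌊N/2⌋). -/
/-- A sequence of naturals whose increments are at most `c` grows at most linearly with slope `c`. -/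
theorem le_add_mul_of_succ_le_add (f : ℕ → ℕ) (c : ℕ) (h : ∀ n, f (n + 1) ≤ f n + c) (n : ℕ) :
    f n ≤ f 0 + c * n := by
  induction n with
  | zero => simp
  | succ n ih => linarith [h n]

/-- Lower bound of Corollary 1 of the paper: since at most `⌊N/2⌋` data are
delivered per slot (half-duplex constraint), any time `τend` at which data
sharing is complete satisfies `⌊N/2⌋ · τend ≥ N² - N`. -/
theorem data_sharing_lower_bound {V : Type*} [Fintype V] [DecidableEq V]
    (N : ℕ) (hN : Fintype.card V = N) (hN2 : 2 ≤ N)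
    (d : ℕ → V → Finset V)
    (hinit : ∀ v, d 0 v = {v})
    (hmono : ∀ τ v, d τ v ⊆ d (τ + 1) v)
    (hhalf : ∀ τ, ∑ v, (d (τ + 1) v).card ≤ (∑ v, (d τ v).card) + N / 2)
    (τend : ℕ) (hend : ∀ v, d τend v = Finset.univ) :
    N ^ 2 - N ≤ (N / 2) * τend := by
  have hbound := le_add_mul_of_succ_le_add (fun τ => ∑ v, (d τ v).card) (N / 2) hhalf τend
  simp only [hinit, hend, Finset.card_singleton, Finset.card_univ, Finset.sum_const, hN,
    smul_eq_mul, mul_one] at hbound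
  rw [Nat.sub_le_iff_le_add', sq]
  exact hbound
end

section
/- Let V be a finite vertex set, G a connected simple graph on V, and d : V → Finset V a family of datasets such that v ∈ d v for every vertex v. Suppose no valid transmission exists, i.e., for every pair of adjacent vertices u and v, d u ⊆ d v. Then d v = V for every vertex v; that is, when the data-sharing algorithm terminates (no transmission can be scheduled), every vehicle possesses all data. -/
/-- A set-valued map on vertices that is monotone along edges is monotone along walks. -/
theorem SimpleGraph.Walk.subset_of_adj_subset {V α : Type*} {G : SimpleGraph V}
    {d : V → Finset α} (h : ∀ u v, G.Adj u v → d u ⊆ d v) {u v : V} (p : G.Walk u v) :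
    d u ⊆ d v := by
  induction p with
  | nil => exact Finset.Subset.refl _
  | cons huv _ ih => exact (h _ _ huv).trans ih

/-- Termination-implies-completeness step of the paper's Theorem 1: if no
valid transmission exists on the connected vehicular network graph, then every
vehicle possesses all data. -/
theorem no_transmission_implies_complete {V : Type*} [Fintype V] [DecidableEq V]
    (G : SimpleGraph V) (hG : G.Connected)
    (d : V → Finset V) (hself : ∀ v, v ∈ d v)
    (hno : ∀ u v, G.Adj u v → d u ⊆ d v) :
    ∀ v, d v = Finset.univ := by
  intro v
  refine Finset.eq_univ_of_forall fun u => ?_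
  obtain ⟨p⟩ := hG.preconnected u v
  exact p.subset_of_adj_subset hno (hself u)
end
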